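/- Let (A,β) be a braided Hopf algebra over a field k and let σ be a 2-cocycle on A. Then the convolution product σ₂₁ * β * σ⁻¹, i.e. the bilinear form γ(x,y) = Σ σ(y₁,x₁) β(x₂,y₂) σ⁻¹(x₃,y₃), is a braiding on the twisted Hopf algebra A_σ: it is convolution-invertible, it is a skew pairing on (A_σ, A_σ) with respect to the twisted multiplication, and it satisfies Σ (y₁ · x₁) γ(x₂,y₂) = Σ γ(x₁,y₁) (x₂ · y₂) for all x,y, where · denotes the twisted multiplication. -/

import Mathlib

/-!
STATEMENT 6: Let (A,β) be a braided Hopf algebra over a field k and let σ be a 2-cocycle on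
A.  Then γ = σ₂₁ * β * σ⁻¹, i.e. γ(x,y) = Σ σ(y₁,x₁) β(x₂,y₂) σ⁻¹(x₃,y₃), is a braiding on
the twisted Hopf algebra A_σ: it is convolution-invertible, a skew pairing on (A_σ, A_σ)
with respect to the twisted multiplication, and Σ (y₁·x₁) γ(x₂,y₂) = Σ γ(x₁,y₁) (x₂·y₂).
-/

open TensorProduct Coalgebra LinearMap

noncomputable section

variable {k : Type} [Field k]

/-- Convolution product of linear maps from a coalgebra `C` to an algebra `M`:
`(f * g)(c) = Σ f(c₁) g(c₂)`. -/
def conv {C M : Type} [AddCommGroup C] [Module k C] [Coalgebra k C]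
    [Ring M] [Algebra k M] (f g : C →ₗ[k] M) : C →ₗ[k] M :=
  (LinearMap.mul' k M) ∘ₗ (TensorProduct.map f g) ∘ₗ Coalgebra.comul

/-- `Σ g(c₁) • f(c₂)`. -/
def convL {C M : Type} [AddCommGroup C] [Module k C] [Coalgebra k C]
    [AddCommGroup M] [Module k M] (g : C →ₗ[k] k) (f : C →ₗ[k] M) : C →ₗ[k] M :=
  (TensorProduct.lid k M).toLinearMap ∘ₗ (TensorProduct.map g f) ∘ₗ Coalgebra.comul

/-- `Σ g(c₂) • f(c₁)`. -/
def convR {C M : Type} [AddCommGroup C] [Module k C] [Coalgebra k C]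
    [AddCommGroup M] [Module k M] (f : C →ₗ[k] M) (g : C →ₗ[k] k) : C →ₗ[k] M :=
  (TensorProduct.rid k M).toLinearMap ∘ₗ (TensorProduct.map f g) ∘ₗ Coalgebra.comul

/-- Convolution invertibility of a bilinear form. -/
def IsConvInvertible {C : Type} [AddCommGroup C] [Module k C] [Coalgebra k C]
    (τ : C →ₗ[k] k) : Prop :=
  ∃ τi : C →ₗ[k] k, conv τ τi = Coalgebra.counit ∧ conv τi τ = Coalgebra.counit

/-- A skew pairing on the ordered pair `(A, U)`. -/
structure IsSkewPairing {A U : Type} [Ring A] [Ring U] [HopfAlgebra k A] [HopfAlgebra k U]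
    (τ : A ⊗[k] U →ₗ[k] k) : Prop where
  mul_left : ∀ (b c : A) (u : U),
    τ ((b * c) ⊗ₜ u) = conv (τ ∘ₗ TensorProduct.mk k A U b) (τ ∘ₗ TensorProduct.mk k A U c) u
  mul_right : ∀ (b : A) (u v : U),
    τ (b ⊗ₜ (u * v)) =
      conv (τ ∘ₗ (TensorProduct.mk k A U).flip v) (τ ∘ₗ (TensorProduct.mk k A U).flip u) b
  one_left : ∀ u : U, τ (1 ⊗ₜ u) = Coalgebra.counit u
  one_right : ∀ a : A, τ (a ⊗ₜ 1) = Coalgebra.counit a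

/-- A braiding on a Hopf algebra `A`: a convolution-invertible skew pairing on `(A,A)`
satisfying `Σ b₁a₁ β(a₂,b₂) = Σ β(a₁,b₁) a₂b₂`. -/
structure IsBraiding {A : Type} [Ring A] [HopfAlgebra k A] (β : A ⊗[k] A →ₗ[k] k) : Prop where
  skew : IsSkewPairing β
  invertible : IsConvInvertible β
  compat : ∀ a b : A,
    convR ((LinearMap.mul' k A) ∘ₗ (TensorProduct.comm k A A).toLinearMap) β (a ⊗ₜ b)
      = convL β (LinearMap.mul' k A) (a ⊗ₜ b)

/-- The multiplication of the cocycle twist `A_σ`: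
`x · y = Σ σ(x₁,y₁) x₂y₂ σ⁻¹(x₃,y₃)`, as a linear map `A ⊗ A → A`. -/
def twistMul {A : Type} [Ring A] [Algebra k A] [Coalgebra k A]
    (σ σi : A ⊗[k] A →ₗ[k] k) : A ⊗[k] A →ₗ[k] A :=
  conv (conv ((Algebra.linearMap k A) ∘ₗ σ) (LinearMap.mul' k A))
    ((Algebra.linearMap k A) ∘ₗ σi)

variable {A : Type} [Ring A] [HopfAlgebra k A]

section MonoidTwist

lemma mul_eq_of_mul_eq_mul {R : Type*} [Monoid R] {p p' q r s s' : R} (hp : p' * p = 1)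
    (hs : s * s' = 1) (h : p * q = r * s) : q * s' = p' * r := by
  calc q * s' = p' * p * q * s' := by rw [hp, one_mul]
    _ = p' * (p * q) * s' := by simp only [mul_assoc]
    _ = p' * r * (s * s') := by rw [h]; simp only [mul_assoc]
    _ = p' * r := by rw [hs, mul_one]

lemma inv_mul_inv_eq {R : Type*} [Monoid R] {p p' q q' r r' s s' : R} (hp : p * p' = 1)
    (hq : q * q' = 1) (hr : r' * r = 1) (hs : s' * s = 1) (h : p * q = r * s) :
    q' * p' = s' * r' := by
  refine (left_inv_eq_right_inv (a := p * q) ?_ ?_).symm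
  · calc s' * r' * (p * q) = s' * (r' * r) * s := by rw [h]; simp only [mul_assoc]
      _ = 1 := by rw [hr, mul_one, hs]
  · calc p * q * (q' * p') = p * (q * q') * p' := by simp only [mul_assoc]
      _ = 1 := by rw [hq, mul_one, hp]

lemma eq_one_of_mul_eq_mul_self {R : Type*} [Monoid R] {s s' : R} (hs : s * s' = 1)
    (h : s * s = s) : s = 1 := by
  calc s = s * s * s' := by rw [mul_assoc, hs, mul_one]
    _ = 1 := by rw [h, hs]

variable {S R : Type*} [Monoid S] [Monoid R] {F M : S →* R} {w : S →* S} {c t : R →* R}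
  {σ σi β : S}

/-- Multiplicativity of `σ₂₁ * β * σ⁻¹` in the first variable, in an abstract form: `F` and `M`
stand for evaluation of a form at `(x, y)` and at `(xy, z)`, `w` for the flip, `c` and `t` for
permutations of the variables. -/
lemma twist_mul_left (hw : ∀ s, w (w s) = s) (hc : ∀ r, c (c (c r)) = r) (ht : ∀ r, t (t r) = r)
    (hct : ∀ r, c (t (c r)) = t r) (htF : ∀ s, t (F s) = F (w s))
    (h₁ : σ * σi = 1) (h₂ : σi * σ = 1)
    (hcoc : F σ * M σ = c (F σ) * c (M (w σ)))
    (hcomp : ∀ s, t (M s) * F β = F β * M s)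
    (hβ : M β = c (c (F (w β))) * c (F β)) :
    F σ * M (w σ * β * σi) * F σi = c (c (F (w (w σ * β * σi)))) * c (F (w σ * β * σi)) := by
  have e {N : Type _} [Monoid N] (f : S →* N) : f σ * f σi = 1 := by rw [← map_mul, h₁, map_one]
  have e' {N : Type _} [Monoid N] (f : S →* N) : f σi * f σ = 1 := by rw [← map_mul, h₂, map_one]
  have a₁ : F σ * M (w σ) = c (c (F σ)) * c (c (M σ)) := by
    simpa [hc] using congr(c (c $hcoc)).symm
  have a₂ : M σi * F σi = c (M (w σi)) * c (F σi) :=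
    inv_mul_inv_eq (e F) (e M) (e' (c.comp F)) (e' (c.comp (M.comp w))) hcoc
  have a₃ : c (c (M σ)) * c (c (F (w β))) = c (c (F (w β))) * c (c (t (M σ))) := by
    simpa [ht, htF] using congr(c (c (t $(hcomp σ))))
  have a₄ : c (F β) * c (M (w σi)) = c (t (M (w σi))) * c (F β) := by
    simpa using congr(c $(hcomp (w σi))).symm
  have a₅ : c (c (t (M σ))) * c (t (M (w σi))) = c (c (F (w σi))) * c (F (w σ)) := by
    refine mul_eq_of_mul_eq_mul (p := c (c (F (w σ)))) (s := c (t (M (w σ))))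
      (e' (c.comp (c.comp (F.comp w)))) (e (c.comp (t.comp (M.comp w)))) ?_
    simpa [hct, htF] using congr(c (c (t $hcoc)))
  calc F σ * M (w σ * β * σi) * F σi
      = (F σ * M (w σ)) * M β * (M σi * F σi) := by simp only [map_mul, mul_assoc]
    _ = c (c (F σ)) * (c (c (M σ)) * c (c (F (w β)))) * (c (F β) * c (M (w σi))) * c (F σi) := by
      rw [a₁, a₂, hβ]; simp only [mul_assoc]
    _ = c (c (F σ)) * c (c (F (w β))) * (c (c (t (M σ))) * c (t (M (w σi)))) * c (F β) *
        c (F σi) := by rw [a₃, a₄]; simp only [mul_assoc]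
    _ = _ := by rw [a₅]; simp only [map_mul, hw, mul_assoc]

/-- Multiplicativity of `σ₂₁ * β * σ⁻¹` in the second variable, in the abstract form of
`twist_mul_left`. -/
lemma twist_mul_right (hw : ∀ s, w (w s) = s) (hc : ∀ r, c (c (c r)) = r) (ht : ∀ r, t (t r) = r)
    (hct : ∀ r, c (t (c r)) = t r) (htF : ∀ s, t (F s) = F (w s))
    (h₁ : σ * σi = 1) (h₂ : σi * σ = 1)
    (hcoc : F σ * M σ = c (F σ) * c (M (w σ)))
    (hcomp : ∀ s, t (M s) * F β = F β * M s)
    (hβ : M (w β) = c (F (w β)) * c (c (F β))) :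
    F σ * M (w (w σ * β * σi)) * F σi = c (F (w (w σ * β * σi))) * c (c (F (w σ * β * σi))) := by
  have e {N : Type _} [Monoid N] (f : S →* N) : f σ * f σi = 1 := by rw [← map_mul, h₁, map_one]
  have e' {N : Type _} [Monoid N] (f : S →* N) : f σi * f σ = 1 := by rw [← map_mul, h₂, map_one]
  have a₁ : M (w σi) * F σi = c (c (M σi)) * c (c (F σi)) := by
    refine (inv_mul_inv_eq (p := c (c (F σ))) (q := c (c (M σ))) (r := F σ) (s := M (w σ))
      (e (c.comp (c.comp F))) (e (c.comp (c.comp M))) (e' F) (e' (M.comp w)) ?_).symm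
    simpa [hc] using congr(c (c $hcoc))
  have a₂ : c (M (w σ)) * c (F (w β)) = c (F (w β)) * c (t (M (w σ))) := by
    simpa [htF, ht] using congr(c (t $(hcomp (w σ))))
  have a₃ : c (c (F β)) * c (c (M σi)) = c (c (t (M σi))) * c (c (F β)) := by
    simpa using congr(c (c $(hcomp σi))).symm
  have a₄ : c (t (M (w σ))) * c (c (t (M σi))) = c (F (w σi)) * c (c (F (w σ))) := by
    refine mul_eq_of_mul_eq_mul (p := c (F (w σ))) (s := c (c (t (M σ))))
      (e' (c.comp (F.comp w))) (e (c.comp (c.comp (t.comp M)))) ?_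
    simpa [hct, htF] using congr(c (c (t $hcoc))).symm
  calc F σ * M (w (w σ * β * σi)) * F σi
      = (F σ * M σ) * M (w β) * (M (w σi) * F σi) := by simp only [map_mul, hw, mul_assoc]
    _ = c (F σ) * (c (M (w σ)) * c (F (w β))) * (c (c (F β)) * c (c (M σi))) * c (c (F σi)) := by
      rw [hcoc, a₁, hβ]; simp only [mul_assoc]
    _ = c (F σ) * c (F (w β)) * (c (t (M (w σ))) * c (c (t (M σi)))) * c (c (F β)) *
        c (c (F σi)) := by rw [a₂, a₃]; simp only [mul_assoc]
    _ = _ := by rw [a₄]; simp only [map_mul, hw, mul_assoc]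

end MonoidTwist

section Convolution

variable {C D M : Type} [AddCommGroup C] [Module k C] [Coalgebra k C]
  [AddCommGroup D] [Module k D] [Coalgebra k D] [Ring M] [Algebra k M]

open WithConv

lemma conv_eq (f g : C →ₗ[k] M) : conv f g = (toConv f * toConv g).ofConv := rfl

lemma counit_eq_one : (Coalgebra.counit : C →ₗ[k] k) = (1 : WithConv (C →ₗ[k] k)).ofConv := by
  ext; simp [LinearMap.convOne_def]

/-- Precomposition with a coalgebra morphism, as a morphism of convolution algebras. -/
def convPull (g : D →ₗc[k] C) : WithConv (C →ₗ[k] M) →* WithConv (D →ₗ[k] M) where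
  toFun f := toConv (f.ofConv ∘ₗ g.toLinearMap)
  map_one' := by ext; simp [LinearMap.convOne_def]
  map_mul' f h := by
    rw [LinearMap.convMul_comp_coalgHom_distrib]

lemma convPull_apply (g : D →ₗc[k] C) (f : WithConv (C →ₗ[k] M)) (x : D) :
    convPull g f x = f (g x) := rfl

/-- Scalar-valued maps seen in the convolution algebra of `M`-valued maps. -/
def convScalar : WithConv (C →ₗ[k] k) →* WithConv (C →ₗ[k] M) where
  toFun f := toConv (Algebra.linearMap k M ∘ₗ f.ofConv)
  map_one' := by ext; simp [LinearMap.convOne_def]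
  map_mul' f g := by
    have := LinearMap.algHom_comp_convMul_distrib (Algebra.ofId k M) f g
    exact congrArg toConv this

lemma convL_eq (b : C →ₗ[k] k) (f : C →ₗ[k] M) :
    convL b f = (convScalar (toConv b) * toConv f).ofConv := by
  ext c
  simp only [convL, LinearMap.convMul_def, convScalar, LinearMap.comp_apply]
  induction Coalgebra.comul (R := k) c using TensorProduct.induction_on with
  | zero => simp
  | tmul x y => simp [Algebra.smul_def]
  | add x y hx hy => simp_all

lemma convR_eq (b : C →ₗ[k] k) (f : C →ₗ[k] M) :
    convR f b = (toConv f * convScalar (toConv b)).ofConv := by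
  ext c
  simp only [convR, LinearMap.convMul_def, convScalar, LinearMap.comp_apply]
  induction Coalgebra.comul (R := k) c using TensorProduct.induction_on with
  | zero => simp
  | tmul x y => simp [Algebra.smul_def, Algebra.commutes]
  | add x y hx hy => simp_all

lemma twistMul_eq (σ σi : A ⊗[k] A →ₗ[k] k) :
    toConv (twistMul σ σi) =
      convScalar (toConv σ) * toConv (LinearMap.mul' k A) * convScalar (toConv σi) := rfl

end Convolution

section Maps

open WithConv

variable (k A)

/-- The flip of `A ⊗ A` as a coalgebra morphism. -/
def swapHom : A ⊗[k] A →ₗc[k] A ⊗[k] A :=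
  ((Bialgebra.TensorProduct.comm k A A : A ⊗[k] A ≃ₐc[k] A ⊗[k] A) : A ⊗[k] A →ₗc[k] A ⊗[k] A)

/-- `x ⊗ y ⊗ z ↦ ε(z) x ⊗ y`. -/
def forgetHom : (A ⊗[k] A) ⊗[k] A →ₗc[k] A ⊗[k] A :=
  (Coalgebra.TensorProduct.rid k k (A ⊗[k] A)).toCoalgHom.comp
    (Coalgebra.TensorProduct.map (CoalgHom.id k _) (Coalgebra.counitCoalgHom k A))

/-- `x ⊗ y ⊗ z ↦ xy ⊗ z`. -/
def mulHom : (A ⊗[k] A) ⊗[k] A →ₗc[k] A ⊗[k] A :=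
  Coalgebra.TensorProduct.map (Bialgebra.mulCoalgHom k A) (CoalgHom.id k _)


/-- `x ⊗ y ⊗ z ↦ y ⊗ z ⊗ x`. -/
def cycleHom : (A ⊗[k] A) ⊗[k] A →ₗc[k] (A ⊗[k] A) ⊗[k] A :=
  ((Bialgebra.TensorProduct.comm k A (A ⊗[k] A) : A ⊗[k] (A ⊗[k] A) ≃ₐc[k] (A ⊗[k] A) ⊗[k] A) :
    A ⊗[k] (A ⊗[k] A) →ₗc[k] (A ⊗[k] A) ⊗[k] A).comp
    (Coalgebra.TensorProduct.assoc k k A A A).toCoalgHom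

/-- `x ⊗ y ⊗ z ↦ y ⊗ x ⊗ z`. -/
def transposeHom : (A ⊗[k] A) ⊗[k] A →ₗc[k] (A ⊗[k] A) ⊗[k] A :=
  Coalgebra.TensorProduct.map (swapHom k A) (CoalgHom.id k _)

/-- `x ↦ 1 ⊗ x`. -/
def oneTmulHom (B : Type) [AddCommGroup B] [Module k B] [Coalgebra k B] : B →ₗc[k] A ⊗[k] B :=
  (Coalgebra.TensorProduct.map (Bialgebra.unitBialgHom k A : k →ₗc[k] A) (CoalgHom.id k B)).comp
    (Coalgebra.TensorProduct.lid k B).symm.toCoalgHom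

/-- `x ↦ x ⊗ 1`. -/
def tmulOneHom (B : Type) [AddCommGroup B] [Module k B] [Coalgebra k B] : B →ₗc[k] B ⊗[k] A :=
  (Coalgebra.TensorProduct.map (CoalgHom.id k B) (Bialgebra.unitBialgHom k A : k →ₗc[k] A)).comp
    (Coalgebra.TensorProduct.rid k k B).symm.toCoalgHom

variable {k A}

@[simp] lemma swapHom_tmul (x y : A) : swapHom k A (x ⊗ₜ y) = y ⊗ₜ x := rfl

@[simp] lemma forgetHom_tmul (w : A ⊗[k] A) (z : A) :
    forgetHom k A (w ⊗ₜ z) = Coalgebra.counit (R := k) z • w := rfl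

@[simp] lemma mulHom_tmul (w : A ⊗[k] A) (z : A) :
    mulHom k A (w ⊗ₜ z) = (LinearMap.mul' k A w) ⊗ₜ z := rfl

@[simp] lemma cycleHom_tmul (x y z : A) :
    cycleHom k A (x ⊗ₜ y ⊗ₜ z) = y ⊗ₜ z ⊗ₜ x := rfl

@[simp] lemma transposeHom_tmul (w : A ⊗[k] A) (z : A) :
    transposeHom k A (w ⊗ₜ z) = swapHom k A w ⊗ₜ z := rfl

@[simp] lemma oneTmulHom_apply {B : Type} [AddCommGroup B] [Module k B] [Coalgebra k B] (x : B) :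
    oneTmulHom k A B x = 1 ⊗ₜ x := by
  change (algebraMap k A 1) ⊗ₜ x = _
  rw [map_one]

@[simp] lemma tmulOneHom_apply {B : Type} [AddCommGroup B] [Module k B] [Coalgebra k B] (x : B) :
    tmulOneHom k A B x = x ⊗ₜ 1 := by
  change x ⊗ₜ (algebraMap k A 1) = _
  rw [map_one]

lemma ext_triple {f g : WithConv ((A ⊗[k] A) ⊗[k] A →ₗ[k] k)}
    (h : ∀ x y z : A, f (x ⊗ₜ y ⊗ₜ z) = g (x ⊗ₜ y ⊗ₜ z)) : f = g := by
  apply WithConv.ofConv_injective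
  ext x y z
  exact h x y z

lemma sum_counit_right {B : Type} [AddCommGroup B] [Module k B] [Coalgebra k B] {N : Type}
    [AddCommGroup N] [Module k N] (φ : B →ₗ[k] N) (x : B) {ι : Type} (r : Coalgebra.Repr k x ι) :
    ∑ i ∈ r.index, Coalgebra.counit (R := k) (r.right i) • φ (r.left i) = φ x := by
  have h := congr(φ (TensorProduct.rid k B $(Coalgebra.sum_tmul_counit_eq r)))
  simpa only [map_sum, TensorProduct.rid_tmul, map_smul, one_smul] using h

lemma sum_counit_left {B : Type} [AddCommGroup B] [Module k B] [Coalgebra k B] {N : Type}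
    [AddCommGroup N] [Module k N] (φ : B →ₗ[k] N) (x : B) {ι : Type} (r : Coalgebra.Repr k x ι) :
    ∑ i ∈ r.index, Coalgebra.counit (R := k) (r.left i) • φ (r.right i) = φ x := by
  have h := congr(φ (TensorProduct.lid k B $(Coalgebra.sum_counit_tmul_eq r)))
  simpa only [map_sum, TensorProduct.lid_tmul, map_smul, one_smul] using h

lemma conv_apply {B : Type} [AddCommGroup B] [Module k B] [Coalgebra k B] (f g : B →ₗ[k] k)
    (x : B) {ι : Type} (r : Coalgebra.Repr k x ι) :
    conv f g x = ∑ i ∈ r.index, f (r.left i) * g (r.right i) :=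
  r.convMul_apply (toConv f) (toConv g)

lemma convL_apply {B N : Type} [AddCommGroup B] [Module k B] [Coalgebra k B] [AddCommGroup N]
    [Module k N] (b : B →ₗ[k] k) (f : B →ₗ[k] N) (x : B) {ι : Type} (r : Coalgebra.Repr k x ι) :
    convL b f x = ∑ i ∈ r.index, b (r.left i) • f (r.right i) := by
  simp [convL, ← r.eq]

lemma convR_apply {B N : Type} [AddCommGroup B] [Module k B] [Coalgebra k B] [AddCommGroup N]
    [Module k N] (b : B →ₗ[k] k) (f : B →ₗ[k] N) (x : B) {ι : Type} (r : Coalgebra.Repr k x ι) :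
    convR f b x = ∑ i ∈ r.index, b (r.right i) • f (r.left i) := by
  simp [convR, ← r.eq]

lemma forget_mul_rTensor (b s : A ⊗[k] A →ₗ[k] k) (h : A ⊗[k] A →ₗ[k] A) :
    convPull (forgetHom k A) (toConv b) * toConv (s ∘ₗ h.rTensor A) =
      toConv (s ∘ₗ (convL b h).rTensor A) := by
  refine ext_triple fun x y z => ?_
  let w := x ⊗ₜ[k] y
  change _ = s (convL b h w ⊗ₜ z)
  rw [((ℛ k w).tmul (ℛ k z)).convMul_apply, convL_apply _ _ _ (ℛ k w)]
  simp only [Coalgebra.Repr.tmul_index, Coalgebra.Repr.tmul_left, Coalgebra.Repr.tmul_right,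
    Finset.sum_product, convPull_apply, forgetHom_tmul,
    LinearMap.comp_apply, LinearMap.rTensor_tmul, sum_tmul, map_sum, ← smul_tmul', map_smul]
  refine Finset.sum_congr rfl fun i _ => ?_
  have key := sum_counit_left (s ∘ₗ TensorProduct.mk k A A (h ((ℛ k w).right i))) z (ℛ k z)
  simp only [LinearMap.comp_apply, TensorProduct.mk_apply] at key
  rw [← key, Finset.smul_sum]
  refine Finset.sum_congr rfl fun j _ => ?_
  simp only [smul_eq_mul]
  ring

lemma rTensor_mul_forget (b s : A ⊗[k] A →ₗ[k] k) (h : A ⊗[k] A →ₗ[k] A) :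
    toConv (s ∘ₗ h.rTensor A) * convPull (forgetHom k A) (toConv b) =
      toConv (s ∘ₗ (convR h b).rTensor A) := by
  refine ext_triple fun x y z => ?_
  let w := x ⊗ₜ[k] y
  change _ = s (convR h b w ⊗ₜ z)
  rw [((ℛ k w).tmul (ℛ k z)).convMul_apply, convR_apply _ _ _ (ℛ k w)]
  simp only [Coalgebra.Repr.tmul_index, Coalgebra.Repr.tmul_left, Coalgebra.Repr.tmul_right,
    Finset.sum_product, convPull_apply, forgetHom_tmul,
    LinearMap.comp_apply, LinearMap.rTensor_tmul, sum_tmul, map_sum, ← smul_tmul', map_smul]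
  refine Finset.sum_congr rfl fun i _ => ?_
  have key := sum_counit_right (s ∘ₗ TensorProduct.mk k A A (h ((ℛ k w).left i))) z (ℛ k z)
  simp only [LinearMap.comp_apply, TensorProduct.mk_apply] at key
  rw [← key, Finset.smul_sum]
  refine Finset.sum_congr rfl fun j _ => ?_
  simp only [smul_eq_mul]
  ring

lemma convPull_mulHom (s : A ⊗[k] A →ₗ[k] k) :
    convPull (mulHom k A) (toConv s) = toConv (s ∘ₗ (LinearMap.mul' k A).rTensor A) := rfl

lemma convPull_transposeHom_mulHom (s : A ⊗[k] A →ₗ[k] k) :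
    convPull (transposeHom k A) (convPull (mulHom k A) (toConv s)) =
      toConv (s ∘ₗ
        (LinearMap.mul' k A ∘ₗ (TensorProduct.comm k A A).toLinearMap).rTensor A) :=
  ext_triple fun _ _ _ => rfl

/-- `Σ f(x, z₁) g(y, z₂)`. -/
lemma forget_forget_apply (f g : A ⊗[k] A →ₗ[k] k) (x y z : A) :
    (convPull (cycleHom k A) (convPull (cycleHom k A)
        (convPull (forgetHom k A) (convPull (swapHom k A) (toConv f)))) *
      convPull (cycleHom k A) (convPull (forgetHom k A) (toConv g))) (x ⊗ₜ y ⊗ₜ z)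
      = conv (f ∘ₗ TensorProduct.mk k A A x) (g ∘ₗ TensorProduct.mk k A A y) z := by
  rw [(((ℛ k x).tmul (ℛ k y)).tmul (ℛ k z)).convMul_apply, conv_apply _ _ _ (ℛ k z)]
  simp only [Coalgebra.Repr.tmul_index, Coalgebra.Repr.tmul_left, Coalgebra.Repr.tmul_right,
    Finset.sum_product, convPull_apply, forgetHom_tmul, cycleHom_tmul,
    swapHom_tmul, map_smul, smul_eq_mul]
  simp_rw [fun i => Finset.sum_comm (s := (ℛ k y).index) (t := (ℛ k z).index)
    (f := fun j l => Coalgebra.counit (R := k) ((ℛ k y).left j) *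
      f ((ℛ k x).left i ⊗ₜ (ℛ k z).left l) * (Coalgebra.counit (R := k) ((ℛ k x).right i) *
        g ((ℛ k y).right j ⊗ₜ (ℛ k z).right l)))]
  rw [Finset.sum_comm]
  refine Finset.sum_congr rfl fun l _ => ?_
  have hx := sum_counit_right (f ∘ₗ (TensorProduct.mk k A A).flip ((ℛ k z).left l)) x (ℛ k x)
  have hy := sum_counit_left (g ∘ₗ (TensorProduct.mk k A A).flip ((ℛ k z).right l)) y (ℛ k y)
  simp only [LinearMap.comp_apply, TensorProduct.mk_apply, LinearMap.flip_apply,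
    smul_eq_mul] at hx hy ⊢
  rw [← hx, ← hy, Finset.sum_mul_sum]
  exact Finset.sum_congr rfl fun i _ => Finset.sum_congr rfl fun j _ => by ring

/-- `Σ f(z₁, y) g(z₂, x)`. -/
lemma forget_forget_apply' (f g : A ⊗[k] A →ₗ[k] k) (x y z : A) :
    (convPull (cycleHom k A) (convPull (forgetHom k A) (convPull (swapHom k A) (toConv f))) *
      convPull (cycleHom k A) (convPull (cycleHom k A) (convPull (forgetHom k A) (toConv g))))
        (x ⊗ₜ y ⊗ₜ z)
      = conv (f ∘ₗ (TensorProduct.mk k A A).flip y) (g ∘ₗ (TensorProduct.mk k A A).flip x) z := by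
  have h := forget_forget_apply (f ∘ₗ (swapHom k A).toLinearMap)
    (g ∘ₗ (swapHom k A).toLinearMap) y x z
  rw [← swapHom_tmul, ← transposeHom_tmul, ← convPull_apply, map_mul] at h
  refine Eq.trans (congrArg (fun s : WithConv ((A ⊗[k] A) ⊗[k] A →ₗ[k] k) => s (x ⊗ₜ y ⊗ₜ z))
    (congrArg₂ (· * ·) ?_ ?_)) h
  all_goals exact ext_triple fun _ _ _ => by simp [convPull_apply]

variable {σ σi β : A ⊗[k] A →ₗ[k] k}

lemma cocycle_identity
    (hcoc : ∀ x y z : A,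
      conv σ (σ ∘ₗ ((TensorProduct.mk k A A).flip z) ∘ₗ LinearMap.mul' k A) (x ⊗ₜ y)
        = conv σ (σ ∘ₗ (TensorProduct.mk k A A x) ∘ₗ LinearMap.mul' k A) (y ⊗ₜ z)) :
    convPull (forgetHom k A) (toConv σ) * convPull (mulHom k A) (toConv σ) =
      convPull (cycleHom k A) (convPull (forgetHom k A) (toConv σ)) *
        convPull (cycleHom k A) (convPull (mulHom k A) (convPull (swapHom k A) (toConv σ))) := by
  have conv_comp (φ : A →ₗ[k] k) (w : A ⊗[k] A) :
      conv σ (φ ∘ₗ LinearMap.mul' k A) w = φ (convL σ (LinearMap.mul' k A) w) := by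
    rw [conv_apply _ _ _ (ℛ k w), convL_apply _ _ _ (ℛ k w)]
    simp
  refine ext_triple fun x y z => ?_
  rw [← map_mul, convPull_apply, cycleHom_tmul, convPull_mulHom, forget_mul_rTensor]
  have h := forget_mul_rTensor σ (σ ∘ₗ (swapHom k A).toLinearMap) (LinearMap.mul' k A)
  refine ((conv_comp (σ ∘ₗ (TensorProduct.mk k A A).flip z) _).symm.trans (hcoc x y z)).trans
    ((conv_comp (σ ∘ₗ TensorProduct.mk k A A x) _).trans ?_)
  exact congr($h (y ⊗ₜ z ⊗ₜ x)).symm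

lemma braiding_comm (hβ : IsBraiding β) (s : WithConv (A ⊗[k] A →ₗ[k] k)) :
    convPull (transposeHom k A) (convPull (mulHom k A) s) *
        convPull (forgetHom k A) (toConv β) =
      convPull (forgetHom k A) (toConv β) * convPull (mulHom k A) s := by
  have h : convR (LinearMap.mul' k A ∘ₗ (TensorProduct.comm k A A).toLinearMap) β =
      convL β (LinearMap.mul' k A) := TensorProduct.ext' hβ.compat
  rw [← toConv_ofConv s, convPull_transposeHom_mulHom, rTensor_mul_forget, h, convPull_mulHom,
    forget_mul_rTensor]

lemma twistMul_eq_convR_convL :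
    twistMul σ σi = convR (convL σ (LinearMap.mul' k A)) σi := by
  rw [convR_eq, convL_eq]
  rfl

lemma apply_twistMul_tmul (f : A ⊗[k] A →ₗ[k] k) (w : A ⊗[k] A) (z : A) :
    f (twistMul σ σi w ⊗ₜ z) = (convPull (forgetHom k A) (toConv σ) *
      convPull (mulHom k A) (toConv f) * convPull (forgetHom k A) (toConv σi)) (w ⊗ₜ z) := by
  rw [convPull_mulHom, forget_mul_rTensor, rTensor_mul_forget, twistMul_eq_convR_convL]
  rfl

lemma convPull_swapHom_swapHom (s : WithConv (A ⊗[k] A →ₗ[k] k)) :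
    convPull (swapHom k A) (convPull (swapHom k A) s) = s := by
  apply WithConv.ofConv_injective
  ext
  rfl

lemma convPull_cycleHom_cube (s : WithConv ((A ⊗[k] A) ⊗[k] A →ₗ[k] k)) :
    convPull (cycleHom k A) (convPull (cycleHom k A) (convPull (cycleHom k A) s)) = s :=
  ext_triple fun _ _ _ => rfl

lemma convPull_transposeHom_transposeHom (s : WithConv ((A ⊗[k] A) ⊗[k] A →ₗ[k] k)) :
    convPull (transposeHom k A) (convPull (transposeHom k A) s) = s :=
  ext_triple fun _ _ _ => rfl

lemma convPull_cycleHom_transposeHom_cycleHom (s : WithConv ((A ⊗[k] A) ⊗[k] A →ₗ[k] k)) :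
    convPull (cycleHom k A) (convPull (transposeHom k A) (convPull (cycleHom k A) s)) =
      convPull (transposeHom k A) s :=
  ext_triple fun _ _ _ => rfl

lemma convPull_transposeHom_forgetHom (s : WithConv (A ⊗[k] A →ₗ[k] k)) :
    convPull (transposeHom k A) (convPull (forgetHom k A) s) =
      convPull (forgetHom k A) (convPull (swapHom k A) s) :=
  ext_triple fun _ _ _ => by simp [convPull_apply]

lemma convPull_mulHom_eq (h : IsSkewPairing β) :
    convPull (mulHom k A) (toConv β) =
      convPull (cycleHom k A) (convPull (cycleHom k A) (convPull (forgetHom k A)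
        (convPull (swapHom k A) (toConv β)))) *
      convPull (cycleHom k A) (convPull (forgetHom k A) (toConv β)) := by
  refine ext_triple fun x y z => ?_
  rw [forget_forget_apply]
  exact h.mul_left x y z

lemma convPull_mulHom_swapHom_eq (h : IsSkewPairing β) :
    convPull (mulHom k A) (convPull (swapHom k A) (toConv β)) =
      convPull (cycleHom k A) (convPull (forgetHom k A)
        (convPull (swapHom k A) (toConv β))) *
      convPull (cycleHom k A) (convPull (cycleHom k A) (convPull (forgetHom k A) (toConv β))) := by
  refine ext_triple fun x y z => ?_
  rw [forget_forget_apply']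
  exact h.mul_right z x y

lemma convPull_oneTmulHom_eq_one (hone : σ ((1 : A) ⊗ₜ (1 : A)) = 1)
    (hinv : toConv σ * toConv σi = 1)
    (hcoc : convPull (forgetHom k A) (toConv σ) * convPull (mulHom k A) (toConv σ) =
      convPull (cycleHom k A) (convPull (forgetHom k A) (toConv σ)) *
        convPull (cycleHom k A) (convPull (mulHom k A) (convPull (swapHom k A) (toConv σ)))) :
    convPull (oneTmulHom k A A) (toConv σ) = 1 := by
  let j : A →ₗc[k] (A ⊗[k] A) ⊗[k] A :=
    (Coalgebra.TensorProduct.assoc k k A A A).symm.toCoalgHom.comp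
      ((oneTmulHom k A _).comp (oneTmulHom k A A))
  have hj (x : A) : j x = 1 ⊗ₜ 1 ⊗ₜ x := by
    change (Coalgebra.TensorProduct.assoc k k A A A).symm (oneTmulHom k A _ (oneTmulHom k A A x)) = _
    simp
  have h := congr(convPull j $hcoc)
  have e₁ : convPull j (convPull (forgetHom k A) (toConv σ)) = 1 := by
    ext x
    simp [hj, convPull_apply, hone]
  have e₂ : convPull j (convPull (mulHom k A) (toConv σ)) =
      convPull (oneTmulHom k A A) (toConv σ) := by
    ext x
    simp [hj, convPull_apply]
  have e₃ : convPull j (convPull (cycleHom k A) (convPull (forgetHom k A) (toConv σ))) =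
      convPull (oneTmulHom k A A) (toConv σ) := by
    ext x
    simp [hj, convPull_apply]
  have e₄ : convPull j (convPull (cycleHom k A) (convPull (mulHom k A)
      (convPull (swapHom k A) (toConv σ)))) = convPull (oneTmulHom k A A) (toConv σ) := by
    ext x
    simp [hj, convPull_apply]
  rw [map_mul, map_mul, e₁, e₂, e₃, e₄] at h
  exact eq_one_of_mul_eq_mul_self (by rw [← map_mul, hinv, map_one]) (h.symm.trans (one_mul _))

lemma convPull_tmulOneHom_eq_one (hone : σ ((1 : A) ⊗ₜ (1 : A)) = 1)
    (hinv : toConv σ * toConv σi = 1)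
    (hcoc : convPull (forgetHom k A) (toConv σ) * convPull (mulHom k A) (toConv σ) =
      convPull (cycleHom k A) (convPull (forgetHom k A) (toConv σ)) *
        convPull (cycleHom k A) (convPull (mulHom k A) (convPull (swapHom k A) (toConv σ)))) :
    convPull (tmulOneHom k A A) (toConv σ) = 1 := by
  let j : A →ₗc[k] (A ⊗[k] A) ⊗[k] A := (tmulOneHom k A _).comp (tmulOneHom k A A)
  have hj (x : A) : j x = x ⊗ₜ 1 ⊗ₜ 1 := by
    change tmulOneHom k A _ (tmulOneHom k A A x) = _
    simp
  have h := congr(convPull j $hcoc)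
  have e₁ : convPull j (convPull (forgetHom k A) (toConv σ)) =
      convPull (tmulOneHom k A A) (toConv σ) := by
    ext x
    simp [hj, convPull_apply]
  have e₂ : convPull j (convPull (mulHom k A) (toConv σ)) =
      convPull (tmulOneHom k A A) (toConv σ) := by
    ext x
    simp [hj, convPull_apply]
  have e₃ : convPull j (convPull (cycleHom k A) (convPull (forgetHom k A) (toConv σ))) = 1 := by
    ext x
    simp [hj, convPull_apply, hone]
  have e₄ : convPull j (convPull (cycleHom k A) (convPull (mulHom k A)
      (convPull (swapHom k A) (toConv σ)))) = convPull (tmulOneHom k A A) (toConv σ) := by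
    ext x
    simp [hj, convPull_apply]
  rw [map_mul, map_mul, e₁, e₂, e₃, e₄] at h
  exact eq_one_of_mul_eq_mul_self (by rw [← map_mul, hinv, map_one]) (h.trans (one_mul _))

lemma convScalar_twist_comm (hβ : IsBraiding β)
    (hinv₂ : toConv σi * toConv σ = 1) {γ : A ⊗[k] A →ₗ[k] k}
    (hγ : toConv γ = convPull (swapHom k A) (toConv σ) * toConv β * toConv σi) :
    convR (twistMul σ σi ∘ₗ (TensorProduct.comm k A A).toLinearMap) γ =
      convL γ (twistMul σ σi) := by
  have hcomp : convPull (swapHom k A) (toConv (LinearMap.mul' k A)) * convScalar (toConv β) =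
      convScalar (toConv β) * toConv (LinearMap.mul' k A) := by
    have h : convR (LinearMap.mul' k A ∘ₗ (TensorProduct.comm k A A).toLinearMap) β =
        convL β (LinearMap.mul' k A) := TensorProduct.ext' hβ.compat
    rw [convR_eq, convL_eq] at h
    exact WithConv.ofConv_injective h
  have hop : toConv (twistMul σ σi ∘ₗ (TensorProduct.comm k A A).toLinearMap) =
      convPull (swapHom k A) (convScalar (toConv σ)) *
        convPull (swapHom k A) (toConv (LinearMap.mul' k A)) *
          convPull (swapHom k A) (convScalar (toConv σi)) := by
    rw [← map_mul, ← map_mul, ← twistMul_eq]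
    rfl
  have hs : convScalar (convPull (swapHom k A) (toConv σ)) =
    convPull (swapHom k A) (convScalar (M := A) (toConv σ)) := rfl
  have h₁ : convPull (swapHom k A) (convScalar (M := A) (toConv σi)) *
      convPull (swapHom k A) (convScalar (M := A) (toConv σ)) = 1 := by
    rw [← map_mul, ← map_mul, hinv₂, map_one, map_one]
  have h₂ : convScalar (M := A) (toConv σi) * convScalar (M := A) (toConv σ) = 1 := by
    rw [← map_mul, hinv₂, map_one]
  rw [convR_eq, convL_eq, hop, twistMul_eq, hγ, map_mul, map_mul, hs]
  refine congrArg WithConv.ofConv ?_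
  generalize convPull (swapHom k A) (convScalar (M := A) (toConv σ)) = s at *
  generalize convPull (swapHom k A) (convScalar (M := A) (toConv σi)) = s' at *
  generalize convPull (swapHom k A) (toConv (LinearMap.mul' k A)) = m' at *
  generalize convScalar (M := A) (toConv σ) = r at *
  generalize convScalar (M := A) (toConv σi) = r' at *
  generalize convScalar (M := A) (toConv β) = b at *
  generalize toConv (LinearMap.mul' k A) = m at *
  calc s * m' * s' * (s * b * r') = s * m' * (s' * s) * b * r' := by simp only [mul_assoc]
    _ = s * (m' * b) * r' := by rw [h₁]; simp only [mul_one, mul_assoc]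
    _ = s * b * (r' * r) * m * r' := by rw [hcomp, h₂]; simp only [mul_one, mul_assoc]
    _ = s * b * r' * (r * m * r') := by simp only [mul_assoc]

lemma exists_conv_inverse (hβ : IsConvInvertible β) (hinv₁ : toConv σ * toConv σi = 1)
    (hinv₂ : toConv σi * toConv σ = 1) {γ : A ⊗[k] A →ₗ[k] k}
    (hγ : toConv γ = convPull (swapHom k A) (toConv σ) * toConv β * toConv σi) :
    IsConvInvertible γ := by
  obtain ⟨βi, h₁, h₂⟩ := hβ
  rw [conv_eq, counit_eq_one] at h₁ h₂
  have u : IsUnit (toConv γ) := by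
    rw [hγ]
    have hσ : IsUnit (toConv σ) := ⟨⟨_, _, hinv₁, hinv₂⟩, rfl⟩
    have hb : IsUnit (toConv β) :=
      ⟨⟨_, _, WithConv.ofConv_injective h₁, WithConv.ofConv_injective h₂⟩, rfl⟩
    have hσi : IsUnit (toConv σi) := ⟨⟨_, _, hinv₂, hinv₁⟩, rfl⟩
    exact ((hσ.map _).mul hb).mul hσi
  obtain ⟨⟨g, g', h, h'⟩, rfl : g = toConv γ⟩ := u
  refine ⟨g'.ofConv, ?_, ?_⟩
  · rw [conv_eq, counit_eq_one]
    exact congrArg WithConv.ofConv h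
  · rw [conv_eq, counit_eq_one]
    exact congrArg WithConv.ofConv h'

lemma twist_skew_left (hβ : IsBraiding β) (hinv₁ : toConv σ * toConv σi = 1)
    (hinv₂ : toConv σi * toConv σ = 1)
    (hcoc : convPull (forgetHom k A) (toConv σ) * convPull (mulHom k A) (toConv σ) =
      convPull (cycleHom k A) (convPull (forgetHom k A) (toConv σ)) *
        convPull (cycleHom k A) (convPull (mulHom k A) (convPull (swapHom k A) (toConv σ))))
    {γ : A ⊗[k] A →ₗ[k] k}
    (hγ : toConv γ = convPull (swapHom k A) (toConv σ) * toConv β * toConv σi) (b c u : A) :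
    γ (twistMul σ σi (b ⊗ₜ c) ⊗ₜ u) =
      conv (γ ∘ₗ TensorProduct.mk k A A b) (γ ∘ₗ TensorProduct.mk k A A c) u := by
  have h := twist_mul_left (F := convPull (forgetHom k A)) (M := convPull (mulHom k A))
    (w := convPull (swapHom k A)) (c := convPull (cycleHom k A)) (t := convPull (transposeHom k A))
    convPull_swapHom_swapHom convPull_cycleHom_cube convPull_transposeHom_transposeHom
    convPull_cycleHom_transposeHom_cycleHom convPull_transposeHom_forgetHom hinv₁ hinv₂ hcoc
    (braiding_comm hβ) (convPull_mulHom_eq hβ.skew)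
  rw [← hγ] at h
  rw [apply_twistMul_tmul, ← forget_forget_apply, h]

lemma twist_skew_right (hβ : IsBraiding β) (hinv₁ : toConv σ * toConv σi = 1)
    (hinv₂ : toConv σi * toConv σ = 1)
    (hcoc : convPull (forgetHom k A) (toConv σ) * convPull (mulHom k A) (toConv σ) =
      convPull (cycleHom k A) (convPull (forgetHom k A) (toConv σ)) *
        convPull (cycleHom k A) (convPull (mulHom k A) (convPull (swapHom k A) (toConv σ))))
    {γ : A ⊗[k] A →ₗ[k] k}
    (hγ : toConv γ = convPull (swapHom k A) (toConv σ) * toConv β * toConv σi) (b u v : A) :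
    γ (b ⊗ₜ twistMul σ σi (u ⊗ₜ v)) =
      conv (γ ∘ₗ (TensorProduct.mk k A A).flip v) (γ ∘ₗ (TensorProduct.mk k A A).flip u) b := by
  have h := twist_mul_right (F := convPull (forgetHom k A)) (M := convPull (mulHom k A))
    (w := convPull (swapHom k A)) (c := convPull (cycleHom k A)) (t := convPull (transposeHom k A))
    convPull_swapHom_swapHom convPull_cycleHom_cube convPull_transposeHom_transposeHom
    convPull_cycleHom_transposeHom_cycleHom convPull_transposeHom_forgetHom hinv₁ hinv₂ hcoc
    (braiding_comm hβ) (convPull_mulHom_swapHom_eq hβ.skew)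
  rw [← hγ] at h
  rw [← forget_forget_apply', ← h]
  exact apply_twistMul_tmul (γ ∘ₗ (swapHom k A).toLinearMap) (u ⊗ₜ v) b

lemma twist_one_left (hβ : IsSkewPairing β)
    (hl : convPull (tmulOneHom k A A) (toConv σ) = 1)
    (hri : convPull (oneTmulHom k A A) (toConv σi) = 1)
    {γ : A ⊗[k] A →ₗ[k] k}
    (hγ : toConv γ = convPull (swapHom k A) (toConv σ) * toConv β * toConv σi) (u : A) :
    γ ((1 : A) ⊗ₜ u) = Coalgebra.counit u := by
  have hb : convPull (oneTmulHom k A A) (toConv β) = 1 := by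
    ext x
    simp [convPull_apply, hβ.one_left]
  have hs : convPull (oneTmulHom k A A) (convPull (swapHom k A) (toConv σ)) =
      convPull (tmulOneHom k A A) (toConv σ) := by
    ext x
    simp [convPull_apply]
  have h := congr(convPull (oneTmulHom k A A) $hγ)
  rw [map_mul, map_mul, hs, hl, hb, hri, one_mul, one_mul] at h
  simpa [convPull_apply] using congr($h u)

lemma twist_one_right (hβ : IsSkewPairing β)
    (hr : convPull (oneTmulHom k A A) (toConv σ) = 1)
    (hli : convPull (tmulOneHom k A A) (toConv σi) = 1)
    {γ : A ⊗[k] A →ₗ[k] k}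
    (hγ : toConv γ = convPull (swapHom k A) (toConv σ) * toConv β * toConv σi) (a : A) :
    γ (a ⊗ₜ (1 : A)) = Coalgebra.counit a := by
  have hb : convPull (tmulOneHom k A A) (toConv β) = 1 := by
    ext x
    simp [convPull_apply, hβ.one_right]
  have hs : convPull (tmulOneHom k A A) (convPull (swapHom k A) (toConv σ)) =
      convPull (oneTmulHom k A A) (toConv σ) := by
    ext x
    simp [convPull_apply]
  have h := congr(convPull (tmulOneHom k A A) $hγ)
  rw [map_mul, map_mul, hs, hr, hb, hli, one_mul, one_mul] at h
  simpa [convPull_apply] using congr($h a)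

end Maps

theorem twist_braiding (β : A ⊗[k] A →ₗ[k] k) (hβ : IsBraiding β)
    (σ σi : A ⊗[k] A →ₗ[k] k)
    -- σ is a 2-cocycle with convolution inverse σi:
    (hinv₁ : conv σ σi = Coalgebra.counit) (hinv₂ : conv σi σ = Coalgebra.counit)
    (hone : σ ((1 : A) ⊗ₜ (1 : A)) = 1)
    (hcoc : ∀ x y z : A,
      conv σ (σ ∘ₗ ((TensorProduct.mk k A A).flip z) ∘ₗ LinearMap.mul' k A) (x ⊗ₜ y)
        = conv σ (σ ∘ₗ (TensorProduct.mk k A A x) ∘ₗ LinearMap.mul' k A) (y ⊗ₜ z)) :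
    -- γ = σ₂₁ * β * σ⁻¹:
    ∀ γ : A ⊗[k] A →ₗ[k] k,
      γ = conv (conv (σ ∘ₗ (TensorProduct.comm k A A).toLinearMap) β) σi →
      -- γ is convolution-invertible,
      IsConvInvertible γ ∧
      -- γ is a skew pairing with respect to the twisted multiplication:
      (∀ b c u : A,
        γ ((twistMul σ σi (b ⊗ₜ c)) ⊗ₜ u)
          = conv (γ ∘ₗ TensorProduct.mk k A A b) (γ ∘ₗ TensorProduct.mk k A A c) u) ∧
      (∀ b u v : A,
        γ (b ⊗ₜ (twistMul σ σi (u ⊗ₜ v)))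
          = conv (γ ∘ₗ (TensorProduct.mk k A A).flip v) (γ ∘ₗ (TensorProduct.mk k A A).flip u) b) ∧
      (∀ u : A, γ ((1 : A) ⊗ₜ u) = Coalgebra.counit u) ∧
      (∀ a : A, γ (a ⊗ₜ (1 : A)) = Coalgebra.counit a) ∧
      -- and Σ (y₁ · x₁) γ(x₂,y₂) = Σ γ(x₁,y₁) (x₂ · y₂) for the twisted multiplication ·
      (∀ x y : A,
        convR ((twistMul σ σi) ∘ₗ (TensorProduct.comm k A A).toLinearMap) γ (x ⊗ₜ y)
          = convL γ (twistMul σ σi) (x ⊗ₜ y)) := by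
  have h₁ : WithConv.toConv σ * WithConv.toConv σi = 1 :=
    WithConv.ofConv_injective (hinv₁.trans counit_eq_one)
  have h₂ : WithConv.toConv σi * WithConv.toConv σ = 1 :=
    WithConv.ofConv_injective (hinv₂.trans counit_eq_one)
  have hc := cocycle_identity hcoc
  have hl := convPull_tmulOneHom_eq_one hone h₁ hc
  have hr := convPull_oneTmulHom_eq_one hone h₁ hc
  have hri : convPull (oneTmulHom k A A) (WithConv.toConv σi) = 1 := by
    have h := congr(convPull (oneTmulHom k A A) $h₁)
    rwa [map_mul, map_one, hr, one_mul] at h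
  have hli : convPull (tmulOneHom k A A) (WithConv.toConv σi) = 1 := by
    have h := congr(convPull (tmulOneHom k A A) $h₁)
    rwa [map_mul, map_one, hl, one_mul] at h
  intro γ hγ
  have hγ' : WithConv.toConv γ = convPull (swapHom k A) (WithConv.toConv σ) *
      WithConv.toConv β * WithConv.toConv σi := congrArg WithConv.toConv hγ
  exact ⟨exists_conv_inverse hβ.invertible h₁ h₂ hγ', twist_skew_left hβ h₁ h₂ hc hγ',
    twist_skew_right hβ h₁ h₂ hc hγ', twist_one_left hβ.skew hl hri hγ',
    twist_one_right hβ.skew hr hli hγ',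
    fun x y => congr($(convScalar_twist_comm hβ h₂ hγ') (x ⊗ₜ y))⟩

end
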